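/- Let A be an associative unital ℝ-algebra, let (Γ_a)_{a=0}^{10} satisfy the 11d Clifford relations, let M be a left A-module, and let ρ : {0,…,10} × {0,…,10} → M be antisymmetric (ρ_{ab} = −ρ_{ba}). If the Rarita–Schwinger equation holds, i.e. Σ_{b₁,b₂} Γ^{a b₁ b₂} · ρ_{b₁b₂} = 0 for every a ∈ {0,…,10}, then: (1) Σ_{b₁,b₂} Γ^{b₁b₂} · ρ_{b₁b₂} = 0; (2) Σ_{b₂} Γ^{b₂} · ρ_{b₁b₂} = 0 for every b₁; (3) Σ_{b₁} Γ^{a b₁} · ρ_{b₁b₂} = −ρ^{a}{}_{b₂} for all a, b₂; (4) Σ_{b₁,b₂} Γ^{a₁a₂ b₁b₂} · ρ_{b₁b₂} = −2 ρ^{a₁a₂} for all a₁, a₂. (All index sums run over {0,…,10}.) -/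

import Mathlib

open Matrix BigOperators

noncomputable section

/-- The 11×11 Minkowski metric `η = diag(−1,+1,…,+1)`. -/
def eta (a b : Fin 11) : ℝ :=
  if a = b then (if a = 0 then -1 else 1) else 0

/-- The 11d Clifford relations `Γ_a Γ_b + Γ_b Γ_a = 2 η_{ab} · 1`. -/
def CliffordRel {A : Type*} [Ring A] [Algebra ℝ A] (Γ : Fin 11 → A) : Prop :=
  ∀ a b : Fin 11, Γ a * Γ b + Γ b * Γ a = (2 * eta a b) • (1 : A)

/-- The antisymmetrized Clifford element
`Γ_{a₁⋯a_p} = (1/p!) Σ_{σ ∈ S_p} sgn(σ) Γ_{a_{σ(1)}} ⋯ Γ_{a_{σ(p)}}`. -/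
def gammaA {A : Type*} [Ring A] [Algebra ℝ A] (Γ : Fin 11 → A) (p : ℕ)
    (a : Fin p → Fin 11) : A :=
  (p.factorial : ℝ)⁻¹ • ∑ σ : Equiv.Perm (Fin p),
    ((Equiv.Perm.sign σ : ℤ) : ℝ) • (List.ofFn fun i => Γ (a (σ i))).prod

/-- The Levi-Civita symbol (lower indices): the sign of `(a₁,…,a₁₁)` as a permutation
of `(0,…,10)`, and `0` if two indices coincide; in particular `ε_{0 1 ⋯ 10} = +1`. -/
def epsL (a : Fin 11 → Fin 11) : ℝ :=
  ∑ σ : Equiv.Perm (Fin 11),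
    if (∀ i, a i = σ i) then ((Equiv.Perm.sign σ : ℤ) : ℝ) else 0
/-- The index-raised antisymmetrized Clifford element
`Γ^{a₁⋯a_p} = Σ_b η^{a₁b₁} ⋯ η^{a_pb_p} Γ_{b₁⋯b_p}`. -/
def gammaU {A : Type*} [Ring A] [Algebra ℝ A] (Γ : Fin 11 → A) (p : ℕ)
    (a : Fin p → Fin 11) : A :=
  ∑ b : Fin p → Fin 11, (∏ i, eta (a i) (b i)) • gammaA Γ p b

lemma List.prod_ofFn_smul {A : Type*} [Ring A] [Algebra ℝ A] {n : ℕ}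
    (c : Fin n → ℝ) (f : Fin n → A) :
    (List.ofFn fun i => c i • f i).prod = (∏ i, c i) • (List.ofFn f).prod := by
  induction n with
  | zero => simp
  | succ n ih => simp [List.ofFn_succ, Fin.prod_univ_succ, ih, smul_smul, mul_comm]

section Gamma

variable {A : Type*} [Ring A] [Algebra ℝ A]

/-- The Clifford generators with raised index, `Γ^a = Σ_b η^{ab} Γ_b`. -/
def gammaUp (Γ : Fin 11 → A) (a : Fin 11) : A := eta a a • Γ a

lemma eta_of_ne {a b : Fin 11} (h : a ≠ b) : eta a b = 0 := by simp [eta, h]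

lemma eta_self_mul_self (a : Fin 11) : eta a a * eta a a = 1 := by
  by_cases h : a = 0 <;> simp [eta, h]

lemma sum_eta_smul {N : Type*} [AddCommGroup N] [Module ℝ N] (a : Fin 11) (x : Fin 11 → N) :
    ∑ b, eta a b • x b = eta a a • x a :=
  Finset.sum_eq_single a (fun b _ hb => by rw [eta_of_ne (Ne.symm hb), zero_smul]) (by simp)

lemma gammaU_eq_gammaA (Γ : Fin 11 → A) (p : ℕ) (a : Fin p → Fin 11) :
    gammaU Γ p a = gammaA (gammaUp Γ) p a := by
  rw [gammaU, Finset.sum_eq_single a]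
  · simp only [gammaA, gammaUp, List.prod_ofFn_smul]
    rw [smul_comm]
    congr 1
    rw [Finset.smul_sum]
    refine Finset.sum_congr rfl fun σ _ => ?_
    rw [smul_comm, Equiv.prod_comp σ fun i => eta (a i) (a i)]
  · intro b _ hb
    obtain ⟨i, hi⟩ := Function.ne_iff.mp hb
    rw [Finset.prod_eq_zero (Finset.mem_univ i) (eta_of_ne (Ne.symm hi)), zero_smul]
  · simp

lemma CliffordRel.gammaUp {Γ : Fin 11 → A} (hC : CliffordRel Γ) : CliffordRel (gammaUp Γ) := by
  intro a b
  simp only [_root_.gammaUp, smul_mul_smul_comm]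
  rw [mul_comm (eta b b), ← smul_add, hC a b, smul_smul]
  by_cases hab : a = b
  · subst hab
    rw [eta_self_mul_self, one_mul]
  · simp [eta_of_ne hab]

lemma decomposeFin_symm_apply_two {n : ℕ} (p : Fin (n + 3)) (e : Equiv.Perm (Fin (n + 2))) :
    Equiv.Perm.decomposeFin.symm (p, e) 2 = Equiv.swap 0 p (e 1).succ :=
  Equiv.Perm.decomposeFin_symm_apply_succ e p 1

lemma decomposeFin_symm_apply_three {n : ℕ} (p : Fin (n + 4)) (e : Equiv.Perm (Fin (n + 3))) :
    Equiv.Perm.decomposeFin.symm (p, e) 3 = Equiv.swap 0 p (e 2).succ :=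
  Equiv.Perm.decomposeFin_symm_apply_succ e p 2

variable {G : Fin 11 → A}

lemma CliffordRel.swap (hG : CliffordRel G) (a b : Fin 11) :
    G b * G a = (2 * eta a b) • (1 : A) - G a * G b :=
  eq_sub_of_add_eq' (hG a b)

lemma CliffordRel.swap_assoc (hG : CliffordRel G) (a b : Fin 11) (x : A) :
    G b * (G a * x) = (2 * eta a b) • x - G a * (G b * x) := by
  rw [← mul_assoc, hG.swap a b, sub_mul, smul_mul_assoc, one_mul, mul_assoc]

lemma gammaA_one (a : Fin 11) : gammaA G 1 ![a] = G a := by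
  simp [gammaA]

lemma CliffordRel.gammaA_two (hG : CliffordRel G) (a b : Fin 11) :
    gammaA G 2 ![a, b] = G a * G b - eta a b • (1 : A) := by
  simp [gammaA, Finset.univ_perm_fin_succ, ← Finset.univ_product_univ, Nat.factorial,
    Fin.sum_univ_succ, List.ofFn_succ]
  simp only [hG.swap a b]
  module

lemma CliffordRel.gammaA_three (hG : CliffordRel G) (a b c : Fin 11) :
    gammaA G 3 ![a, b, c] = G a * (G b * G c) - eta a b • G c + eta a c • G b
      - eta b c • G a := by
  simp [gammaA, Finset.univ_perm_fin_succ, ← Finset.univ_product_univ, Finset.sum_product,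
    Nat.factorial, Fin.sum_univ_succ, List.ofFn_succ,
    decomposeFin_symm_apply_two, Equiv.swap_apply_def]
  simp only [hG.swap a b, hG.swap a c, hG.swap b c, hG.swap_assoc a b, hG.swap_assoc a c,
    mul_sub, mul_smul_comm, smul_sub, mul_one]
  module

lemma CliffordRel.gammaA_four (hG : CliffordRel G) (a b c d : Fin 11) :
    gammaA G 4 ![a, b, c, d] = G a * (G b * (G c * G d)) - eta a b • (G c * G d)
      + eta a c • (G b * G d) - eta a d • (G b * G c) - eta b c • (G a * G d)
      + eta b d • (G a * G c) - eta c d • (G a * G b) + (eta a b * eta c d) • (1 : A)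
      - (eta a c * eta b d) • (1 : A) + (eta a d * eta b c) • (1 : A) := by
  simp [gammaA, Finset.univ_perm_fin_succ, ← Finset.univ_product_univ, Finset.sum_product,
    Nat.factorial, Fin.sum_univ_succ, List.ofFn_succ,
    decomposeFin_symm_apply_two, decomposeFin_symm_apply_three, Equiv.swap_apply_def]
  simp only [hG.swap a b, hG.swap a c, hG.swap a d, hG.swap b c, hG.swap b d, hG.swap c d,
    hG.swap_assoc a b, hG.swap_assoc a c, hG.swap_assoc a d, hG.swap_assoc b c,
    hG.swap_assoc b d, mul_sub, mul_smul_comm, smul_sub, mul_one]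
  module

end Gamma

section Contraction

variable {A : Type*} [Ring A] [Algebra ℝ A] {G : Fin 11 → A}
  {M : Type*} [AddCommGroup M] [Module A M] [Module ℝ M] [IsScalarTower ℝ A M]
  {ρ : Fin 11 → Fin 11 → M}

lemma diag_eq_zero (hanti : ∀ a b, ρ a b = - ρ b a) (a : Fin 11) : ρ a a = 0 := by
  have h : (2 : ℝ) • ρ a a = 0 := by
    rw [two_smul, ← eq_neg_iff_add_eq_zero]
    exact hanti a a
  exact (smul_eq_zero.mp h).resolve_left two_ne_zero

/-- The contraction of `Γ^{abc}` with `ρ_{bc}` in terms of the gamma-trace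
`s_b = Σ_c Γ^c · ρ_{bc}`: it equals `Γ^a Σ_b Γ^b · s_b - 2 s^a`. -/
lemma CliffordRel.sum_gammaA_three_smul (hG : CliffordRel G) (hanti : ∀ a b, ρ a b = - ρ b a)
    (a : Fin 11) :
    ∑ b, ∑ c, gammaA G 3 ![a, b, c] • ρ b c =
      G a • ∑ b, G b • ∑ c, G c • ρ b c - (2 * eta a a) • ∑ c, G c • ρ a c := by
  have hout : ∑ b, eta a b • ∑ c, G c • ρ b c = eta a a • ∑ c, G c • ρ a c :=
    sum_eta_smul a fun b => ∑ c, G c • ρ b c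
  have hin : ∑ b, ∑ c, eta a c • G b • ρ b c = -(eta a a • ∑ c, G c • ρ a c) := by
    rw [Finset.smul_sum, ← Finset.sum_neg_distrib]
    refine Finset.sum_congr rfl fun b _ => ?_
    rw [sum_eta_smul a fun c => G b • ρ b c, hanti b a, smul_neg, smul_neg]
  have hdiag : ∑ b, ∑ c, eta b c • G a • ρ b c = 0 := by
    refine Finset.sum_eq_zero fun b _ => ?_
    rw [sum_eta_smul b fun c => G a • ρ b c, diag_eq_zero hanti, smul_zero, smul_zero]
  simp only [hG.gammaA_three, sub_smul, add_smul, mul_smul, smul_assoc, Finset.sum_sub_distrib,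
    Finset.sum_add_distrib, hout, hin, hdiag, ← Finset.smul_sum]
  rw [two_smul]
  abel

/-- A solution of the Rarita–Schwinger equation is gamma-traceless. -/
lemma CliffordRel.sum_smul_eq_zero (hG : CliffordRel G) (hanti : ∀ a b, ρ a b = - ρ b a)
    (hRS : ∀ a, ∑ b, ∑ c, gammaA G 3 ![a, b, c] • ρ b c = 0) (a : Fin 11) :
    ∑ c, G c • ρ a c = 0 := by
  set T := ∑ b, G b • ∑ c, G c • ρ b c with hT
  have hs : ∀ a, G a • T = (2 * eta a a) • ∑ c, G c • ρ a c := fun a =>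
    sub_eq_zero.mp ((hG.sum_gammaA_three_smul hanti a).symm.trans (hRS a))
  have hs' : ∀ a, ∑ c, G c • ρ a c = (2⁻¹ * eta a a) • G a • T := fun a => by
    rw [hs, smul_smul, show 2⁻¹ * eta a a * (2 * eta a a) = eta a a * eta a a by ring,
      eta_self_mul_self, one_smul]
  have hsq : ∀ b, G b • ∑ c, G c • ρ b c = (2⁻¹ : ℝ) • T := fun b => by
    have h1 : G b * G b = eta b b • (1 : A) := by
      have h2 := hG b b
      rw [← two_smul ℝ, mul_smul] at h2
      exact smul_right_injective A (two_ne_zero (α := ℝ)) h2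
    rw [hs', smul_comm, ← mul_smul (G b), h1, smul_assoc, one_smul, smul_smul, mul_assoc,
      eta_self_mul_self, mul_one]
  have hT0 : T = 0 := by
    have h : T = (11 : ℝ) • (2⁻¹ : ℝ) • T := by
      conv_lhs => rw [hT]
      simp only [hsq, Finset.sum_const, Finset.card_univ, Fintype.card_fin]
      module
    have h9 : (9 / 2 : ℝ) • T = 0 := by
      rw [← sub_eq_zero.mpr h.symm]
      module
    exact (smul_eq_zero.mp h9).resolve_left (by norm_num)
  rw [hs', hT0, smul_zero, smul_zero]

lemma CliffordRel.sum_gammaA_two_smul_eq_zero (hG : CliffordRel G)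
    (hanti : ∀ a b, ρ a b = - ρ b a) (hs : ∀ a, ∑ c, G c • ρ a c = 0) :
    ∑ b, ∑ c, gammaA G 2 ![b, c] • ρ b c = 0 := by
  refine Finset.sum_eq_zero fun b _ => ?_
  simp only [hG.gammaA_two, sub_smul, mul_smul, smul_assoc, one_smul, Finset.sum_sub_distrib,
    ← Finset.smul_sum, hs, sum_eta_smul, diag_eq_zero hanti, smul_zero, sub_zero]

lemma CliffordRel.sum_gammaA_two_smul (hG : CliffordRel G) (hanti : ∀ a b, ρ a b = - ρ b a)
    (hs : ∀ a, ∑ c, G c • ρ a c = 0) (a c : Fin 11) :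
    ∑ b, gammaA G 2 ![a, b] • ρ b c = -(eta a a • ρ a c) := by
  have hs' : ∑ b, G b • ρ b c = 0 := by
    simp only [hanti _ c, smul_neg, Finset.sum_neg_distrib, hs, neg_zero]
  simp only [hG.gammaA_two, sub_smul, mul_smul, smul_assoc, one_smul, Finset.sum_sub_distrib,
    ← Finset.smul_sum, hs', smul_zero, zero_sub]
  rw [sum_eta_smul a fun b => ρ b c]

lemma CliffordRel.sum_gammaA_four_smul (hG : CliffordRel G) (hanti : ∀ a b, ρ a b = - ρ b a)
    (hs : ∀ a, ∑ c, G c • ρ a c = 0) (a b : Fin 11) :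
    ∑ c, ∑ d, gammaA G 4 ![a, b, c, d] • ρ c d = (-2 * eta a a * eta b b) • ρ a b := by
  have hs' : ∀ d, ∑ c, G c • ρ c d = 0 := fun d => by
    simp only [hanti _ d, smul_neg, Finset.sum_neg_distrib, hs, neg_zero]
  simp only [hG.gammaA_four, sub_smul, add_smul, mul_smul, smul_assoc, one_smul,
    Finset.sum_sub_distrib, Finset.sum_add_distrib, ← Finset.smul_sum, sum_eta_smul, hs, hs',
    diag_eq_zero hanti, smul_zero, Finset.sum_const_zero]
  rw [hanti b a]
  module

end Contraction

/-- Algebraic implications of the Rarita–Schwinger equation: if `ρ` is antisymmetric and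
`Σ_{b₁b₂} Γ^{a b₁ b₂} · ρ_{b₁b₂} = 0` for all `a`, then
(1) `Σ Γ^{b₁b₂} · ρ_{b₁b₂} = 0`, (2) `Σ_{b₂} Γ^{b₂} · ρ_{b₁b₂} = 0`,
(3) `Σ_{b₁} Γ^{a b₁} · ρ_{b₁b₂} = −ρ^a{}_{b₂}`,
(4) `Σ_{b₁b₂} Γ^{a₁a₂ b₁b₂} · ρ_{b₁b₂} = −2 ρ^{a₁a₂}`. -/
theorem rarita_schwinger_algebraic_implications
    {A : Type*} [Ring A] [Algebra ℝ A] (Γ : Fin 11 → A) (hC : CliffordRel Γ)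
    {M : Type*} [AddCommGroup M] [Module A M]
    (ρ : Fin 11 → Fin 11 → M) (hanti : ∀ a b, ρ a b = - ρ b a)
    (hRS : ∀ a : Fin 11,
      (∑ b₁ : Fin 11, ∑ b₂ : Fin 11, gammaU Γ 3 ![a, b₁, b₂] • ρ b₁ b₂) = 0) :
    ((∑ b₁ : Fin 11, ∑ b₂ : Fin 11, gammaU Γ 2 ![b₁, b₂] • ρ b₁ b₂) = 0) ∧
    (∀ b₁ : Fin 11, (∑ b₂ : Fin 11, gammaU Γ 1 ![b₂] • ρ b₁ b₂) = 0) ∧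
    (∀ a b₂ : Fin 11,
      (∑ b₁ : Fin 11, gammaU Γ 2 ![a, b₁] • ρ b₁ b₂)
        = - ∑ a' : Fin 11, algebraMap ℝ A (eta a a') • ρ a' b₂) ∧
    (∀ a₁ a₂ : Fin 11,
      (∑ b₁ : Fin 11, ∑ b₂ : Fin 11, gammaU Γ 4 ![a₁, a₂, b₁, b₂] • ρ b₁ b₂)
        = ∑ b₁ : Fin 11, ∑ b₂ : Fin 11,
            algebraMap ℝ A (-2 * eta a₁ b₁ * eta a₂ b₂) • ρ b₁ b₂) := by
  let : Module ℝ M := Module.compHom M (algebraMap ℝ A)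
  have : IsScalarTower ℝ A M := ⟨fun r x m => by
    rw [Algebra.smul_def, mul_smul]
    rfl⟩
  have hG := hC.gammaUp
  simp only [gammaU_eq_gammaA, gammaA_one, algebraMap_smul] at hRS ⊢
  have hs := hG.sum_smul_eq_zero hanti hRS
  refine ⟨hG.sum_gammaA_two_smul_eq_zero hanti hs, hs, fun a c => ?_, fun a b => ?_⟩
  · rw [hG.sum_gammaA_two_smul hanti hs, sum_eta_smul a fun b => ρ b c]
  · rw [hG.sum_gammaA_four_smul hanti hs]
    simp only [mul_smul, ← Finset.smul_sum, sum_eta_smul]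

end
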